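/- Cocycle property of spin transport along a flow (skew-product law): let Φ : ℝ → E → E (E := ℝ³ × ℝ³, phase space) satisfy Φ(0)(z) = z and Φ(s+t)(z) = Φ(s)(Φ(t)(z)) for all s, t ∈ ℝ and z ∈ E; let C : E → ℝ³ be such that for every z the map t ↦ C(Φ(t)(z)) is continuous; and let D : E → ℝ → Matrix (Fin 2) (Fin 2) ℂ satisfy, for every z ∈ E, D(z)(0) = I₂ and HasDerivAt (D z) (−(i/2)·((C(Φ(t)(z)))·σ)·D(z)(t)) t for all t. Then for all z ∈ E and s, t ∈ ℝ, D(z)(t+s) = D(Φ(t)(z))(s) · D(z)(t). -/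

import Mathlib

open Matrix Complex

noncomputable section

/-- The Pauli matrices `σ₁, σ₂, σ₃` as `2 × 2` complex matrices. -/
def pauli : Fin 3 → Matrix (Fin 2) (Fin 2) ℂ
  | 0 => !![0, 1; 1, 0]
  | 1 => !![0, -Complex.I; Complex.I, 0]
  | 2 => !![1, 0; 0, -1]

/-- `v·σ = v₁σ₁ + v₂σ₂ + v₃σ₃`. -/
def pauliVec (v : Fin 3 → ℝ) : Matrix (Fin 2) (Fin 2) ℂ :=
  (v 0 : ℂ) • pauli 0 + (v 1 : ℂ) • pauli 1 + (v 2 : ℂ) • pauli 2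

/-- Phase space `E = ℝ³ × ℝ³`. -/
abbrev PhaseSpace : Type := (Fin 3 → ℝ) × (Fin 3 → ℝ)

attribute [local instance] Matrix.normedAddCommGroup Matrix.normedSpace

theorem pauliVec_isHermitian (v : Fin 3 → ℝ) : (pauliVec v).IsHermitian := by
  ext i j
  fin_cases i <;> fin_cases j <;> simp [pauliVec, pauli]

theorem hasDerivAt_matrix_iff {m n : Type*} [Fintype m] [Fintype n]
    {F : ℝ → Matrix m n ℂ} {F' : Matrix m n ℂ} {t : ℝ} :
    HasDerivAt F F' t ↔ ∀ i j, HasDerivAt (fun u => F u i j) (F' i j) t := by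
  refine (hasDerivAt_pi (φ := F) (φ' := F')).trans (forall_congr' fun i => ?_)
  exact hasDerivAt_pi (φ := fun u => F u i) (φ' := F' i)

theorem hasDerivAt_conjTranspose_mul {l m n : Type*} [Fintype l] [Fintype m] [Fintype n]
    {F : ℝ → Matrix m l ℂ} {G : ℝ → Matrix m n ℂ} {F' : Matrix m l ℂ} {G' : Matrix m n ℂ} {t : ℝ}
    (hF : HasDerivAt F F' t) (hG : HasDerivAt G G' t) :
    HasDerivAt (fun u => (F u)ᴴ * G u) (F'ᴴ * G t + (F t)ᴴ * G') t := by
  rw [hasDerivAt_matrix_iff] at hF hG ⊢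
  intro i j
  simp only [Matrix.add_apply, Matrix.mul_apply, conjTranspose_apply, ← Finset.sum_add_distrib]
  exact HasDerivAt.fun_sum fun k _ => (hF k i).star.mul (hG k j)

/-- The sesquilinear pairing of two solutions of `F' = -(i/2) H F` with `H` Hermitian is
conserved. -/
theorem conjTranspose_mul_eq_of_hasDerivAt {l m n : Type*} [Fintype l] [Fintype m] [Fintype n]
    {H : ℝ → Matrix m m ℂ} (hH : ∀ t, (H t).IsHermitian)
    {F : ℝ → Matrix m l ℂ} {G : ℝ → Matrix m n ℂ}
    (hF : ∀ t, HasDerivAt F (-((Complex.I / 2) • (H t * F t))) t)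
    (hG : ∀ t, HasDerivAt G (-((Complex.I / 2) • (H t * G t))) t) (s t : ℝ) :
    (F s)ᴴ * G s = (F t)ᴴ * G t := by
  have h (u : ℝ) : HasDerivAt (fun u => (F u)ᴴ * G u) 0 u := by
    convert hasDerivAt_conjTranspose_mul (hF u) (hG u) using 1
    simp [conjTranspose_smul, conjTranspose_mul, (hH u).eq, Matrix.mul_assoc, neg_div]
  exact is_const_of_deriv_eq_zero (fun u => (h u).differentiableAt) (fun u => (h u).deriv) s t

/-- cocycle property of spin transport along a flow
(skew-product law): `D(z)(t+s) = D(Φᵗz)(s) · D(z)(t)`. -/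
theorem spinTransport_cocycle (Φ : ℝ → PhaseSpace → PhaseSpace)
    (hΦ0 : ∀ z : PhaseSpace, Φ 0 z = z)
    (hΦ : ∀ s t : ℝ, ∀ z : PhaseSpace, Φ (s + t) z = Φ s (Φ t z))
    (C : PhaseSpace → Fin 3 → ℝ)
    (hC : ∀ z : PhaseSpace, Continuous fun t : ℝ => C (Φ t z))
    (D : PhaseSpace → ℝ → Matrix (Fin 2) (Fin 2) ℂ)
    (hD0 : ∀ z : PhaseSpace, D z 0 = 1)
    (hD : ∀ z : PhaseSpace, ∀ t : ℝ,
      HasDerivAt (D z) (-((Complex.I / 2) • (pauliVec (C (Φ t z)) * D z t))) t) :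
    ∀ z : PhaseSpace, ∀ s t : ℝ, D z (t + s) = D (Φ t z) s * D z t := by
  intro z s t
  have hF (u : ℝ) : HasDerivAt (fun u => D z (t + u))
      (-((Complex.I / 2) • (pauliVec (C (Φ u (Φ t z))) * D z (t + u)))) u := by
    rw [← hΦ, add_comm u t]
    exact (hD z (t + u)).comp_const_add t u
  have hH (u : ℝ) := pauliVec_isHermitian (C (Φ u (Φ t z)))
  have hunit := conjTranspose_mul_eq_of_hasDerivAt hH (hD (Φ t z)) (hD (Φ t z)) s 0
  have hpair := conjTranspose_mul_eq_of_hasDerivAt hH (hD (Φ t z)) hF s 0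
  simp only [hD0, conjTranspose_one, one_mul, add_zero] at hunit hpair
  rw [← hpair, ← Matrix.mul_assoc, mul_eq_one_comm.mp hunit, one_mul]

end
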